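/- Let n ≥ 2, s ∈ (0,1), let f : ℝⁿ → ℝⁿ be a bi-Lipschitz homeomorphism with Lipschitz constants Lip(f) = L and Lip(f⁻¹) = L', and let Ω ⊆ ℝⁿ be measurable. Define w_F(x) = 1_F(x) ∫_{ℝⁿ∖F} |x−y|^{−(n+s)} dy for measurable F ⊆ ℝⁿ. Then w_{f(Ω)}(x) ≤ Lⁿ (L')^{n+s} w_Ω(f⁻¹(x)) for every x ∈ ℝⁿ. -/

import Mathlib

open MeasureTheory Filter Metric
open scoped ENNReal NNReal Topology

/-- The function `w_F(x) = 1_F(x) ∫_{ℝⁿ∖F} |x−y|^{-(n+s)} dy`, with values in `ℝ≥0∞`. -/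
noncomputable def wFun (n : ℕ) (s : ℝ) (F : Set (EuclideanSpace ℝ (Fin n)))
    (x : EuclideanSpace ℝ (Fin n)) : ℝ≥0∞ :=
  Set.indicator F (fun z => ∫⁻ y in Fᶜ, ENNReal.ofReal (‖z - y‖ ^ (-((n : ℝ) + s)))) x

/-- A `K`-Lipschitz self-map of a `d`-dimensional space increases Haar measures by a factor at most
`K ^ d`. -/
theorem LipschitzWith.addHaar_image_le {E : Type*} [NormedAddCommGroup E] [NormedSpace ℝ E]
    [FiniteDimensional ℝ E] [MeasurableSpace E] [BorelSpace E] (μ : Measure E)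
    [μ.IsAddHaarMeasure] {K : ℝ≥0} {f : E → E} (hf : LipschitzWith K f) (A : Set E) :
    μ (f '' A) ≤ (K : ℝ≥0∞) ^ Module.finrank ℝ E * μ A := by
  have h := hf.hausdorffMeasure_image_le (d := Module.finrank ℝ E) (Nat.cast_nonneg _) A
  rw [ENNReal.rpow_natCast] at h
  rw [Measure.isAddLeftInvariant_eq_smul μ (Measure.hausdorffMeasure (Module.finrank ℝ E)),
    Measure.smul_apply, Measure.smul_apply, ENNReal.smul_def, ENNReal.smul_def, smul_eq_mul,
    smul_eq_mul, mul_left_comm]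
  gcongr

/-- Pushing a Haar measure forward by the inverse of a `K`-Lipschitz map increases it by a factor
at most `K ^ d`. -/
theorem LipschitzWith.map_inverse_addHaar_le {E : Type*} [NormedAddCommGroup E] [NormedSpace ℝ E]
    [FiniteDimensional ℝ E] [MeasurableSpace E] [BorelSpace E] (μ : Measure E)
    [μ.IsAddHaarMeasure] {K : ℝ≥0} {f g : E → E} (hf : LipschitzWith K f) (hg : Measurable g)
    (hfg : Function.LeftInverse g f) (hgf : Function.RightInverse g f) :
    μ.map g ≤ (K : ℝ≥0∞) ^ Module.finrank ℝ E • μ := by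
  refine Measure.le_iff.2 fun A hA => ?_
  rw [Measure.map_apply hg hA, ← Set.image_eq_preimage_of_inverse hfg hgf]
  exact hf.addHaar_image_le μ A

/-- Negative powers of distances increase by a factor at most `K ^ p` under an injective
`K`-Lipschitz map. -/
theorem LipschitzWith.ofReal_norm_sub_rpow_neg_le {E F : Type*} [NormedAddCommGroup E]
    [NormedAddCommGroup F] {K : ℝ≥0} {g : E → F} (hg : LipschitzWith K g) {p : ℝ} (hp : 0 ≤ p)
    {x y : E} (hxy : g x ≠ g y) :
    ENNReal.ofReal (‖x - y‖ ^ (-p)) ≤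
      (K : ℝ≥0∞) ^ p * ENNReal.ofReal (‖g x - g y‖ ^ (-p)) := by
  have hpos : 0 < ‖g x - g y‖ := norm_sub_pos_iff.2 hxy
  have hle := hg.norm_sub_le x y
  have hx : 0 < ‖x - y‖ := norm_sub_pos_iff.2 fun h => hxy (congrArg g h)
  rw [← ENNReal.ofReal_coe_nnreal, ENNReal.ofReal_rpow_of_nonneg K.coe_nonneg hp,
    ← ENNReal.ofReal_mul (by positivity)]
  refine ENNReal.ofReal_le_ofReal ?_
  rw [Real.rpow_neg hx.le, Real.rpow_neg hpos.le, ← div_eq_mul_inv, inv_eq_one_div,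
    div_le_div_iff₀ (by positivity) (by positivity), one_mul, ← Real.mul_rpow K.coe_nonneg hx.le]
  exact Real.rpow_le_rpow hpos.le hle hp

/-- Lemma A.3, quantitative form: if `f` is a bi-Lipschitz homeomorphism
of `ℝⁿ` with `Lip(f) = L`, `Lip(f⁻¹) = L'`, then `w_{f(Ω)}(x) ≤ Lⁿ (L')^{n+s} w_Ω(f⁻¹(x))`. -/
theorem stmt19 (n : ℕ) (hn : 2 ≤ n) (s : ℝ) (hs : s ∈ Set.Ioo (0 : ℝ) 1)
    (f g : EuclideanSpace ℝ (Fin n) → EuclideanSpace ℝ (Fin n))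
    (hfg : Function.LeftInverse g f) (hgf : Function.RightInverse g f)
    (L L' : NNReal) (hf : LipschitzWith L f) (hg : LipschitzWith L' g)
    (Ω : Set (EuclideanSpace ℝ (Fin n))) (hΩ : MeasurableSet Ω)
    (x : EuclideanSpace ℝ (Fin n)) :
    wFun n s (f '' Ω) x ≤ (L : ℝ≥0∞) ^ n * (L' : ℝ≥0∞) ^ ((n : ℝ) + s) * wFun n s Ω (g x) := by
  have hp : 0 ≤ (n : ℝ) + s := add_nonneg n.cast_nonneg hs.1.le
  have himage : f '' Ω = g ⁻¹' Ω := congrFun (Set.image_eq_preimage_of_inverse hfg hgf) Ω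
  by_cases hx : g x ∈ Ω
  swap
  · have hx' : x ∉ f '' Ω := himage ▸ hx
    simp [wFun, hx']
  have hx' : x ∈ f '' Ω := himage ▸ hx
  have hgm : Measurable g := hg.continuous.measurable
  have hker : Measurable fun z : EuclideanSpace ℝ (Fin n) =>
      ENNReal.ofReal (‖g x - z‖ ^ (-((n : ℝ) + s))) := by fun_prop
  have hmap := hf.map_inverse_addHaar_le volume hgm hfg hgf
  rw [finrank_euclideanSpace_fin] at hmap
  simp only [wFun, Set.indicator_of_mem hx, Set.indicator_of_mem hx']
  calc ∫⁻ y in (f '' Ω)ᶜ, ENNReal.ofReal (‖x - y‖ ^ (-((n : ℝ) + s)))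
      ≤ ∫⁻ y in g ⁻¹' Ωᶜ,
          (L' : ℝ≥0∞) ^ ((n : ℝ) + s) * ENNReal.ofReal (‖g x - g y‖ ^ (-((n : ℝ) + s))) := by
        rw [himage, ← Set.preimage_compl]
        exact setLIntegral_mono' (hgm hΩ.compl) fun y hy =>
          hg.ofReal_norm_sub_rpow_neg_le hp (ne_of_mem_of_not_mem hx hy)
    _ = (L' : ℝ≥0∞) ^ ((n : ℝ) + s) *
          ∫⁻ z in Ωᶜ, ENNReal.ofReal (‖g x - z‖ ^ (-((n : ℝ) + s))) ∂(volume.map g) := by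
        rw [lintegral_const_mul _ (by fun_prop), setLIntegral_map hΩ.compl hker hgm]
    _ ≤ (L' : ℝ≥0∞) ^ ((n : ℝ) + s) * ((L : ℝ≥0∞) ^ n *
          ∫⁻ z in Ωᶜ, ENNReal.ofReal (‖g x - z‖ ^ (-((n : ℝ) + s)))) := by
        rw [← smul_eq_mul ((L : ℝ≥0∞) ^ n), ← lintegral_smul_measure, ← Measure.restrict_smul]
        gcongr
    _ = _ := by rw [mul_left_comm, mul_assoc]
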